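/- Let Y be a normed vector space and A, B ⊆ Y nonempty sets. If every point of A lies within distance r of the closed convex hull of B, and every point of B lies within distance r of the closed convex hull of A, then the Hausdorff distance between the closed convex hulls of A and B is at most r. -/

import Mathlib

theorem stmt_1_aux {Y : Type*} [NormedAddCommGroup Y] [NormedSpace ℝ Y]
    (A B : Set Y) (hB : B.Nonempty) (r : ℝ) (hr : 0 ≤ r)
    (hAB : ∀ a ∈ A, Metric.infDist a (closure (convexHull ℝ B)) ≤ r) :
    ∀ a ∈ closure (convexHull ℝ A), Metric.infDist a (closure (convexHull ℝ B)) ≤ r := by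
  have hne : (closure (convexHull ℝ B)).Nonempty := (hB.mono (subset_convexHull ℝ B)).closure
  have key : ∀ a, a ∈ Metric.cthickening r (closure (convexHull ℝ B)) ↔
      Metric.infDist a (closure (convexHull ℝ B)) ≤ r := fun a => by
    rw [Metric.mem_cthickening_iff, Metric.infDist,
      ENNReal.le_ofReal_iff_toReal_le (Metric.infEDist_ne_top hne) hr]
  have h : closure (convexHull ℝ A) ⊆ Metric.cthickening r (closure (convexHull ℝ B)) :=
    closure_minimal (convexHull_min (fun a ha => (key a).2 (hAB a ha))
      ((convex_convexHull ℝ B).closure.cthickening r)) Metric.isClosed_cthickening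
  exact fun a ha => (key a).1 (h ha)

/-- If every point of `A` is within distance `r` of the closed convex hull of `B` and
vice versa, then the Hausdorff distance between the closed convex hulls is at most `r`. -/
theorem stmt_1 {Y : Type*} [NormedAddCommGroup Y] [NormedSpace ℝ Y]
    (A B : Set Y) (hA : A.Nonempty) (hB : B.Nonempty) (r : ℝ)
    (hAB : ∀ a ∈ A, Metric.infDist a (closure (convexHull ℝ B)) ≤ r)
    (hBA : ∀ b ∈ B, Metric.infDist b (closure (convexHull ℝ A)) ≤ r) :
    Metric.hausdorffDist (closure (convexHull ℝ A)) (closure (convexHull ℝ B)) ≤ r := by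
  have hr : 0 ≤ r := by
    obtain ⟨a, ha⟩ := hA
    exact Metric.infDist_nonneg.trans (hAB a ha)
  exact Metric.hausdorffDist_le_of_infDist hr (stmt_1_aux A B hB r hr hAB)
    (stmt_1_aux B A hA r hr hBA)
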